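/- arXiv:2012.05851 — 2 statements merged into one kernel-verified Lean document; each statement's English description precedes it below -/
import Mathlib

section
/- Let n ≥ 3 be an integer, let R be a regular n-gon in ℝ², and let Q be a convex polygon in ℝ² with exactly n vertices. If area(Q) = area(R) and perimeter(Q) = perimeter(R), then Q is congruent to R, i.e., there is an isometry of ℝ² mapping Q onto R. -/
open Real MeasureTheory

/-- A convex `n`-gon: a compact convex subset of the plane which is the convex hull of a
finite set and whose set of extreme points has exactly `n` elements. -/
def IsConvexNGon (n : ℕ) (P : Set (EuclideanSpace ℝ (Fin 2))) : Prop :=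
  IsCompact P ∧ Convex ℝ P ∧ (∃ S : Finset (EuclideanSpace ℝ (Fin 2)), P = convexHull ℝ ↑S) ∧
    (Set.extremePoints ℝ P).ncard = n

/-- The area of a planar region: its two-dimensional Lebesgue measure. -/
noncomputable def polygonArea (P : Set (EuclideanSpace ℝ (Fin 2))) : ℝ :=
  (volume P).toReal

/-- The perimeter of a planar region: the one-dimensional Hausdorff measure of its boundary. -/
noncomputable def polygonPerimeter (P : Set (EuclideanSpace ℝ (Fin 2))) : ℝ :=
  (μH[1] (frontier P)).toReal

/-- A regular `n`-gon: the convex hull of `n` equally spaced points on some circle of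
positive radius (equivalently, a convex `n`-gon all of whose sides have equal length and
all of whose interior angles are equal). -/
def IsRegularNGon (n : ℕ) (P : Set (EuclideanSpace ℝ (Fin 2))) : Prop :=
  ∃ (c : EuclideanSpace ℝ (Fin 2)) (r θ : ℝ), 0 < r ∧
    P = convexHull ℝ (Set.range fun k : Fin n =>
      c + r • (WithLp.equiv 2 (Fin 2 → ℝ)).symm
        ![Real.cos (θ + 2 * π * k / n), Real.sin (θ + 2 * π * k / n)])

namespace PlanarPolygon

open Finset ComplexConjugate

/-- The determinant of two plane vectors. -/
def cross (a b : ℂ) : ℝ := a.re * b.im - a.im * b.re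

variable {n : ℕ} [NeZero n]

/-- Twice the signed area enclosed by the closed polygonal line with vertices `z`. -/
noncomputable def shoelace (z : ZMod n → ℂ) : ℝ := ∑ k, cross (z k) (z (k + 1))

/-- The length of the closed polygonal line with vertices `z`. -/
noncomputable def edgeSum (z : ZMod n → ℂ) : ℝ := ∑ k, ‖z (k + 1) - z k‖

/-- The sum of the squared edge lengths of the closed polygonal line with vertices `z`. -/
noncomputable def edgeEnergy (z : ZMod n → ℂ) : ℝ := ∑ k, ‖z (k + 1) - z k‖ ^ 2

lemma sum_comp_add_one {M : Type*} [AddCommMonoid M] (f : ZMod n → M) :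
    ∑ k, f (k + 1) = ∑ k, f k :=
  Equiv.sum_comp (Equiv.addRight (1 : ZMod n)) f

lemma parseval (z : ZMod n → ℂ) : ∑ j, ‖ZMod.dft z j‖ ^ 2 = n * ∑ k, ‖z k‖ ^ 2 := by
  have hn : (n : ℂ) ≠ 0 := NeZero.ne _
  have hinv (k : ZMod n) : ∑ j, ZMod.stdAddChar (j * k) * ZMod.dft z j = n * z k := by
    have h := ZMod.invDFT_apply (ZMod.dft z) k
    rw [LinearEquiv.symm_apply_apply, smul_eq_mul] at h
    rw [h, mul_inv_cancel_left₀ hn]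
    simp
  have hc : ∑ j, conj (ZMod.dft z j) * ZMod.dft z j = n * ∑ k, conj (z k) * z k := by
    calc ∑ j, conj (ZMod.dft z j) * ZMod.dft z j
        = ∑ k, ∑ j, conj (ZMod.stdAddChar (j * k) * ZMod.dft z j) * z k := by
          rw [sum_comm]
          refine sum_congr rfl fun j _ => ?_
          nth_rw 2 [ZMod.dft_apply z j]
          rw [mul_sum]
          refine sum_congr rfl fun k _ => ?_
          rw [AddChar.map_neg_eq_conj, smul_eq_mul, map_mul (starRingEnd ℂ), mul_comm k j]
          ring
      _ = n * ∑ k, conj (z k) * z k := by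
          rw [mul_sum]
          refine sum_congr rfl fun k _ => ?_
          rw [← sum_mul, ← map_sum, hinv, map_mul, Complex.conj_natCast, mul_assoc]
  simp only [Complex.conj_mul'] at hc
  exact_mod_cast hc

lemma dft_comp_add_one (z : ZMod n → ℂ) (j : ZMod n) :
    ZMod.dft (fun k => z (k + 1)) j = ZMod.stdAddChar j * ZMod.dft z j := by
  rw [ZMod.dft_apply, ZMod.dft_apply, mul_sum,
    ← sum_comp_add_one (fun k => ZMod.stdAddChar j * _)]
  refine sum_congr rfl fun k _ => ?_
  rw [smul_eq_mul, smul_eq_mul, ← mul_assoc, ← AddChar.map_add_eq_mul]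
  congr 2
  ring

/-- The centre of the circle orthogonal to the unit circle at `1` and `exp (2 * π * I / n)`. -/
noncomputable def spectralCentre (n : ℕ) : ℂ := 1 + Real.tan (π / n) * Complex.I

lemma edgeEnergy_sub_shoelace (z : ZMod n → ℂ) :
    n * (edgeEnergy z - 2 * Real.tan (π / n) * shoelace z) =
      ∑ j, (‖ZMod.stdAddChar j - spectralCentre n‖ ^ 2 - Real.tan (π / n) ^ 2)
        * ‖ZMod.dft z j‖ ^ 2 := by
  have h := parseval (fun k => z (k + 1) - spectralCentre n * z k)
  have hd (j : ZMod n) : ZMod.dft (fun k => z (k + 1) - spectralCentre n * z k) j =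
      (ZMod.stdAddChar j - spectralCentre n) * ZMod.dft z j := by
    have : (fun k => z (k + 1) - spectralCentre n * z k) =
      (fun k => z (k + 1)) - spectralCentre n • z := by ext; simp
    rw [this, map_sub, map_smul, Pi.sub_apply, dft_comp_add_one, Pi.smul_apply, smul_eq_mul,
      sub_mul]
  simp only [hd, norm_mul, mul_pow] at h
  simp only [sub_mul, sum_sub_distrib]
  rw [h, ← mul_sum, parseval z]
  have key : ∑ k, (‖z (k + 1) - spectralCentre n * z k‖ ^ 2 - Real.tan (π / n) ^ 2 * ‖z k‖ ^ 2
      - ‖z (k + 1) - z k‖ ^ 2 + 2 * Real.tan (π / n) * cross (z k) (z (k + 1))) = 0 := by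
    refine sum_eq_zero fun k _ => ?_
    simp only [← Complex.normSq_eq_norm_sq, Complex.normSq_apply, spectralCentre, cross]
    generalize Real.tan (π / n) = t
    simp
    ring
  simp only [sum_add_distrib, sum_sub_distrib, ← mul_sum] at key
  simp only [edgeEnergy, shoelace]
  linear_combination (-(n : ℝ)) * key

lemma cos_pi_div_pos {n : ℕ} (hn : 3 ≤ n) : 0 < Real.cos (π / n) := by
  have hn' : (3 : ℝ) ≤ n := by exact_mod_cast hn
  apply Real.cos_pos_of_mem_Ioo
  have : π / n ≤ π / 3 := by gcongr
  constructor <;> linarith [Real.pi_pos, show 0 < π / n by positivity]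

lemma stdAddChar_natCast (m : ℕ) :
    ZMod.stdAddChar (m : ZMod n) = Complex.exp ((2 * (π * m / n) : ℝ) * Complex.I) := by
  have := ZMod.stdAddChar_coe (N := n) m
  push_cast at this
  rw [this]
  congr 1
  push_cast
  ring

lemma norm_stdAddChar_sub_spectralCentre (hn : 3 ≤ n) (m : ℕ) :
    ‖ZMod.stdAddChar (m : ZMod n) - spectralCentre n‖ ^ 2 - Real.tan (π / n) ^ 2 =
      4 * Real.sin (π * m / n) * Real.sin (π * (m - 1) / n) / Real.cos (π / n) := by
  have hc := cos_pi_div_pos hn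
  have he : ZMod.stdAddChar (m : ZMod n) =
      Real.cos (2 * (π * m / n)) + Real.sin (2 * (π * m / n)) * Complex.I := by
    rw [stdAddChar_natCast, Complex.exp_ofReal_mul_I]
  have hs : π * (m - 1) / n = π * m / n - π / n := by ring
  rw [he, ← Complex.normSq_eq_norm_sq, Complex.normSq_apply, spectralCentre,
    Real.tan_eq_sin_div_cos, hs, Real.sin_sub, Real.cos_two_mul, Real.sin_two_mul]
  have h := Real.sin_sq_add_cos_sq (π * m / n)
  generalize Real.sin (π * m / n) = S at *
  generalize Real.cos (π * m / n) = C at *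
  generalize Real.sin (π / n) = s at *
  generalize Real.cos (π / n) = c at *
  simp only [Complex.add_re, Complex.sub_re, Complex.mul_re, Complex.add_im, Complex.sub_im,
    Complex.mul_im, Complex.ofReal_re, Complex.ofReal_im, Complex.I_re, Complex.I_im,
    Complex.one_re, Complex.one_im]
  field_simp
  linear_combination (-4 * (1 - C ^ 2) * c ^ 2) * h

lemma spectral_weight_pos (hn : 3 ≤ n) {j : ZMod n} (h0 : j ≠ 0) (h1 : j ≠ 1) :
    0 < ‖ZMod.stdAddChar j - spectralCentre n‖ ^ 2 - Real.tan (π / n) ^ 2 := by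
  obtain ⟨m, hm, rfl⟩ : ∃ m : ℕ, m < n ∧ (m : ZMod n) = j :=
    ⟨j.val, j.val_lt, ZMod.natCast_zmod_val j⟩
  have hm2 : 2 ≤ m := by
    by_contra! h
    interval_cases m <;> simp_all
  have hm2' : (2 : ℝ) ≤ m := by exact_mod_cast hm2
  have hm' : (m : ℝ) < n := by exact_mod_cast hm
  have hn0 : (0 : ℝ) < n := by linarith
  rw [norm_stdAddChar_sub_spectralCentre hn]
  have hsin {x : ℝ} (hx : 0 < x) (hxn : x < n) : 0 < Real.sin (π * x / n) := by
    apply Real.sin_pos_of_pos_of_lt_pi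
    · positivity
    · rw [div_lt_iff₀ hn0]
      gcongr
  have := cos_pi_div_pos hn
  have := hsin (x := m) (by linarith) hm'
  have := hsin (x := m - 1) (by linarith) (by linarith)
  positivity

lemma spectral_weight_nonneg (hn : 3 ≤ n) (j : ZMod n) :
    0 ≤ ‖ZMod.stdAddChar j - spectralCentre n‖ ^ 2 - Real.tan (π / n) ^ 2 := by
  by_cases h0 : j = 0
  · subst h0
    simpa using (norm_stdAddChar_sub_spectralCentre hn 0).ge
  by_cases h1 : j = 1
  · subst h1
    simpa using (norm_stdAddChar_sub_spectralCentre hn 1).ge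
  exact (spectral_weight_pos hn h0 h1).le

/-- The discrete Wirtinger inequality. -/
lemma shoelace_le_edgeEnergy (hn : 3 ≤ n) (z : ZMod n → ℂ) :
    2 * Real.tan (π / n) * shoelace z ≤ edgeEnergy z := by
  have h : 0 ≤ n * (edgeEnergy z - 2 * Real.tan (π / n) * shoelace z) := by
    rw [edgeEnergy_sub_shoelace]
    exact sum_nonneg fun j _ => mul_nonneg (spectral_weight_nonneg hn j) (sq_nonneg _)
  have := nonneg_of_mul_nonneg_right h (Nat.cast_pos.2 (NeZero.pos n))
  linarith

lemma exists_eq_of_edgeEnergy_eq (hn : 3 ≤ n) (z : ZMod n → ℂ)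
    (h : edgeEnergy z = 2 * Real.tan (π / n) * shoelace z) :
    ∃ a b : ℂ, ∀ k, z k = a + b * ZMod.stdAddChar k := by
  have h0 := edgeEnergy_sub_shoelace z
  rw [h, sub_self, mul_zero, eq_comm, sum_eq_zero_iff_of_nonneg
    fun j _ => mul_nonneg (spectral_weight_nonneg hn j) (sq_nonneg _)] at h0
  have hdft (j : ZMod n) (hj0 : j ≠ 0) (hj1 : j ≠ 1) : ZMod.dft z j = 0 := by
    have := h0 j (mem_univ j)
    simpa [(spectral_weight_pos hn hj0 hj1).ne'] using this
  have : Fact (1 < n) := ⟨by lia⟩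
  refine ⟨(n : ℂ)⁻¹ * ZMod.dft z 0, (n : ℂ)⁻¹ * ZMod.dft z 1, fun k => ?_⟩
  have hk := ZMod.invDFT_apply (ZMod.dft z) k
  rw [LinearEquiv.symm_apply_apply, ← sum_subset (subset_univ {0, 1}) (by
    intro j _ hj
    simp only [mem_insert, mem_singleton, not_or] at hj
    rw [hdft j hj.1 hj.2, smul_zero]), sum_pair zero_ne_one] at hk
  rw [hk]
  simp
  ring

/-- Twice the signed area of the triangle `a b c`. -/
def orient (a b c : ℂ) : ℝ := cross (b - a) (c - a)

lemma orient_eq (a b c : ℂ) : orient a b c = cross a b + cross b c + cross c a := by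
  simp only [orient, cross, Complex.sub_re, Complex.sub_im]
  ring

/-- Among triangles with a given base and a given sum of the other two sides, an isosceles one has
the largest area. -/
lemma exists_isosceles (a b c : ℂ) : ∃ b' : ℂ,
    ‖b' - a‖ = (‖b - a‖ + ‖c - b‖) / 2 ∧ ‖c - b'‖ = (‖b - a‖ + ‖c - b‖) / 2 ∧
    orient a b c ≤ orient a b' c ∧
    (orient a b c ≠ 0 → ‖b - a‖ ≠ ‖c - b‖ → orient a b c < orient a b' c) := by
  rcases eq_or_ne a c with rfl | hac
  · refine ⟨a + ((‖b - a‖ + ‖a - b‖) / 2 : ℝ), ?_, ?_, ?_, ?_⟩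
    · rw [add_sub_cancel_left, Complex.norm_real, Real.norm_of_nonneg (by positivity)]
    · rw [sub_add_cancel_left, norm_neg, Complex.norm_real, Real.norm_of_nonneg (by positivity)]
    · simp [orient, cross]
    · simp [orient, cross]
  have hd : 0 < ‖c - a‖ := norm_pos_iff.2 (sub_ne_zero.2 hac.symm)
  set d := ‖c - a‖ with hd_def
  set p := ‖b - a‖ with hp_def
  set q := ‖c - b‖ with hq_def
  have hp0 : 0 ≤ p := norm_nonneg _
  have hq0 : 0 ≤ q := norm_nonneg _
  have hd2 : d ^ 2 = (c.re - a.re) ^ 2 + (c.im - a.im) ^ 2 := by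
    rw [hd_def, ← Complex.normSq_eq_norm_sq, Complex.normSq_apply]; simp; ring
  have hp2 : p ^ 2 = (b.re - a.re) ^ 2 + (b.im - a.im) ^ 2 := by
    rw [hp_def, ← Complex.normSq_eq_norm_sq, Complex.normSq_apply]; simp; ring
  have hq2 : q ^ 2 = (c.re - b.re) ^ 2 + (c.im - b.im) ^ 2 := by
    rw [hq_def, ← Complex.normSq_eq_norm_sq, Complex.normSq_apply]; simp; ring
  have hdpq : d ≤ p + q := by
    calc d = ‖(b - a) + (c - b)‖ := by rw [hd_def]; congr 1; ring
      _ ≤ p + q := norm_add_le _ _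
  set h := Real.sqrt (((p + q) / 2) ^ 2 - (d / 2) ^ 2) with hh_def
  have hh : h ^ 2 = ((p + q) / 2) ^ 2 - (d / 2) ^ 2 :=
    Real.sq_sqrt (sub_nonneg.2 (by gcongr))
  have hh0 : 0 ≤ h := Real.sqrt_nonneg _
  have hnorm (ε : ℝ) (hε : ε ^ 2 = 1) :
      ‖(c - a) * (1 / 2 + (ε * (h / d) : ℝ) * Complex.I)‖ = (p + q) / 2 := by
    have h2 (t : ℝ) : ‖(1 / 2 + t * Complex.I : ℂ)‖ ^ 2 = 1 / 4 + t ^ 2 := by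
      rw [← Complex.normSq_eq_norm_sq, Complex.normSq_apply]
      simp
      ring
    rw [norm_mul, ← hd_def, ← sq_eq_sq₀ (by positivity) (by positivity), mul_pow, h2, mul_pow, hε,
      one_mul, div_pow, hh]
    field_simp
    ring
  have hor : orient a (a + (c - a) * (1 / 2 + ((-1) * (h / d) : ℝ) * Complex.I)) c = d * h := by
    have : h * d = h / d * d ^ 2 := by field_simp
    rw [mul_comm d, this, hd2, orient, cross]
    simp
    ring
  have hw : (orient a b c) ^ 2 =
      p ^ 2 * q ^ 2 - ((b.re - a.re) * (c.re - b.re) + (b.im - a.im) * (c.im - b.im)) ^ 2 := by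
    rw [hp2, hq2, orient, cross]
    simp
    ring
  set w := (b.re - a.re) * (c.re - b.re) + (b.im - a.im) * (c.im - b.im) with hw_def
  have hdw : d ^ 2 = p ^ 2 + q ^ 2 + 2 * w := by rw [hd2, hp2, hq2, hw_def]; ring
  have hdiff : (d * h) ^ 2 - orient a b c ^ 2 = (p * q - w) * (p - q) ^ 2 / 2 := by
    rw [mul_pow, hh, hw]
    linear_combination (((p + q) / 2) ^ 2 - (d ^ 2 + p ^ 2 + q ^ 2 + 2 * w) / 4) * hdw
  have hpqw : |w| ≤ p * q := abs_le_of_sq_le_sq (by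
    rw [mul_pow]
    linarith [sq_nonneg (orient a b c)]) (by positivity)
  refine ⟨a + (c - a) * (1 / 2 + ((-1) * (h / d) : ℝ) * Complex.I), ?_, ?_, ?_, ?_⟩
  · rw [add_sub_cancel_left, hnorm _ (by norm_num)]
  · rw [← hnorm 1 (by norm_num)]
    congr 1
    push_cast
    ring
  · rw [hor]
    refine (abs_le_of_sq_le_sq' ?_ (by positivity)).2
    have : 0 ≤ (p * q - w) * (p - q) ^ 2 / 2 := by
      have := sub_nonneg.2 ((le_abs_self w).trans hpqw)
      positivity
    linarith
  · intro h0 hpq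
    rw [hor]
    refine lt_of_pow_lt_pow_left₀ 2 (by positivity) ?_
    have h1 : 0 < (p * q - w) := by
      have h2 : 0 < orient a b c ^ 2 := by positivity
      refine sub_pos.2 (lt_of_le_of_ne ((le_abs_self w).trans hpqw) fun h3 => ?_)
      rw [hw, h3, mul_pow, sub_self] at h2
      exact h2.false
    have h2 : 0 < (p - q) ^ 2 := by
      have := sub_ne_zero.2 hpq
      positivity
    have : 0 < (p * q - w) * (p - q) ^ 2 / 2 := by positivity
    linarith

lemma sum_update_sub_sum (hn : 2 ≤ n) (F : ℂ → ℂ → ℝ) (z : ZMod n → ℂ) (k : ZMod n) (b : ℂ) :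
    ∑ j, F (Function.update z (k + 1) b j) (Function.update z (k + 1) b (j + 1)) -
      ∑ j, F (z j) (z (j + 1)) =
    F (z k) b + F b (z (k + 1 + 1)) - (F (z k) (z (k + 1)) + F (z (k + 1)) (z (k + 1 + 1))) := by
  have : Fact (1 < n) := ⟨by lia⟩
  have h1 (j : ZMod n) : j + 1 ≠ j := by simp
  rw [← sum_sub_distrib, sum_eq_add k (k + 1) (h1 k).symm]
  · rw [Function.update_of_ne (h1 k).symm, Function.update_self, Function.update_of_ne (h1 _)]
    ring
  · intro j _ hj
    rw [Function.update_of_ne hj.2, Function.update_of_ne (by simpa using hj.1), sub_self]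
  · simp
  · simp

/-- Replacing a vertex by the apex of an isosceles triangle keeps the length, does not
decrease the area, and makes the edges more equal. -/
lemma exists_equalize (hn : 2 ≤ n) (z : ZMod n → ℂ) (k : ZMod n)
    (hk : ‖z (k + 1) - z k‖ ≠ ‖z (k + 1 + 1) - z (k + 1)‖) :
    ∃ z' : ZMod n → ℂ, edgeSum z' = edgeSum z ∧ shoelace z ≤ shoelace z' ∧
      edgeEnergy z' < edgeEnergy z ∧
      (orient (z k) (z (k + 1)) (z (k + 1 + 1)) ≠ 0 → shoelace z < shoelace z') := by
  obtain ⟨b, h1, h2, h3, h4⟩ := exists_isosceles (z k) (z (k + 1)) (z (k + 1 + 1))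
  have hS := sum_update_sub_sum hn (fun x y => ‖y - x‖) z k b
  have hE := sum_update_sub_sum hn (fun x y => ‖y - x‖ ^ 2) z k b
  have hA := sum_update_sub_sum hn cross z k b
  simp only [orient_eq (z k)] at h3 h4 ⊢
  refine ⟨Function.update z (k + 1) b, ?_, ?_, ?_, fun h => ?_⟩
  · simp only [edgeSum]
    rw [← sub_eq_zero, hS, h1, h2]
    ring
  · simp only [shoelace]
    linarith
  · simp only [edgeEnergy]
    rw [← sub_neg, hE, h1, h2]
    have := sq_pos_of_ne_zero (sub_ne_zero.2 hk)
    nlinarith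
  · have := h4 h hk
    simp only [shoelace]
    linarith

lemma shoelace_sub_const (z : ZMod n → ℂ) (t : ℂ) : shoelace (fun k => z k - t) = shoelace z := by
  have h (k : ZMod n) : cross (z k - t) (z (k + 1) - t) =
      cross (z k) (z (k + 1)) + (cross t (z k) - cross t (z (k + 1))) := by
    simp only [cross, Complex.sub_re, Complex.sub_im]
    ring
  simp only [shoelace, h]
  rw [sum_add_distrib, sum_sub_distrib, sum_comp_add_one fun k => cross t (z k), sub_self, add_zero]

lemma isCompact_based_polygons (p : ℝ) :
    IsCompact {z : ZMod n → ℂ | z 0 = 0 ∧ edgeSum z ≤ p} := by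
  refine Metric.isCompact_of_isClosed_isBounded ?_ ?_
  · refine (isClosed_eq (continuous_apply 0) continuous_const).inter
      (isClosed_le (f := edgeSum) ?_ continuous_const)
    unfold edgeSum
    fun_prop
  · refine (Metric.isBounded_closedBall (x := 0) (r := n * p)).subset fun z ⟨hz0, hzp⟩ => ?_
    have hedge (k : ZMod n) : ‖z (k + 1) - z k‖ ≤ p :=
      (single_le_sum (f := fun k => ‖z (k + 1) - z k‖) (fun _ _ => norm_nonneg _)
        (mem_univ k)).trans hzp
    have hp : 0 ≤ p := (norm_nonneg _).trans (hedge 0)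
    have hnat (m : ℕ) : ‖z m‖ ≤ m * p := by
      induction m with
      | zero => simp [hz0]
      | succ m ih =>
        have := norm_le_norm_add_norm_sub' (z ((m + 1 : ℕ) : ZMod n)) (z m)
        have := hedge m
        push_cast at *
        linarith
    rw [mem_closedBall_zero_iff, pi_norm_le_iff_of_nonneg (by positivity)]
    intro k
    have hk := hnat k.val
    rw [ZMod.natCast_zmod_val] at hk
    refine hk.trans ?_
    gcongr
    exact k.val_lt.le

lemma edgeSum_sq_of_equilateral (z : ZMod n → ℂ)
    (h : ∀ k, ‖z (k + 1) - z k‖ = ‖z (k + 1 + 1) - z (k + 1)‖) :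
    edgeSum z ^ 2 = n * edgeEnergy z := by
  have hnat (m : ℕ) : ‖z (m + 1) - z m‖ = ‖z (0 + 1) - z 0‖ := by
    induction m with
    | zero => simp
    | succ m ih => rw [← ih, h m]; push_cast; rfl
  have hall (k : ZMod n) : ‖z (k + 1) - z k‖ = ‖z (0 + 1) - z 0‖ := by
    have := hnat k.val
    rwa [ZMod.natCast_zmod_val] at this
  simp only [edgeSum, edgeEnergy, hall, sum_const, card_univ, ZMod.card, nsmul_eq_mul]
  ring

lemma sin_pi_div_pos {n : ℕ} (hn : 3 ≤ n) : 0 < Real.sin (π / n) := by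
  have hn' : (3 : ℝ) ≤ n := by exact_mod_cast hn
  exact Real.sin_pos_of_pos_of_lt_pi (by positivity) (div_lt_self Real.pi_pos (by linarith))

lemma tan_pi_div_pos {n : ℕ} (hn : 3 ≤ n) : 0 < Real.tan (π / n) := by
  rw [Real.tan_eq_sin_div_cos]
  exact div_pos (sin_pi_div_pos hn) (cos_pi_div_pos hn)

/-- The isoperimetric inequality for closed polygonal lines with `n` edges. -/
theorem shoelace_le_edgeSum_sq (hn : 3 ≤ n) (z : ZMod n → ℂ) :
    2 * n * Real.tan (π / n) * shoelace z ≤ edgeSum z ^ 2 := by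
  set K := {z' : ZMod n → ℂ | z' 0 = 0 ∧ edgeSum z' ≤ edgeSum z} with hK_def
  have hK : IsCompact K := isCompact_based_polygons _
  have hcont : Continuous (shoelace : (ZMod n → ℂ) → ℝ) := by
    unfold shoelace cross
    fun_prop
  have hcontE : Continuous (edgeEnergy : (ZMod n → ℂ) → ℝ) := by
    unfold edgeEnergy
    fun_prop
  have htrans {z' : ZMod n → ℂ} (h : edgeSum z' ≤ edgeSum z) : (fun k => z' k - z' 0) ∈ K := by
    refine ⟨sub_self _, ?_⟩
    simpa [edgeSum] using h
  obtain ⟨y, hyK, hy⟩ := hK.exists_isMaxOn ⟨_, htrans le_rfl⟩ hcont.continuousOn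
  have hM : IsCompact (K ∩ {x | shoelace x = shoelace y}) :=
    hK.inter_right (isClosed_eq hcont continuous_const)
  obtain ⟨x, ⟨hxK, hxy⟩, hx⟩ := hM.exists_isMinOn ⟨y, hyK, rfl⟩ hcontE.continuousOn
  have hmax {z' : ZMod n → ℂ} (h : edgeSum z' ≤ edgeSum z) : shoelace z' ≤ shoelace x := by
    rw [hxy, ← shoelace_sub_const z' (z' 0)]
    exact hy (htrans h)
  have heq : ∀ k, ‖x (k + 1) - x k‖ = ‖x (k + 1 + 1) - x (k + 1)‖ := by
    by_contra! ⟨k, hk⟩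
    obtain ⟨x', hS, hA, hE, -⟩ := exists_equalize (by lia) x k hk
    have hS' : edgeSum x' ≤ edgeSum z := hS.trans_le hxK.2
    have hE' := hx ⟨htrans hS', by
      rw [Set.mem_ofPred_eq, shoelace_sub_const, ← hxy]
      exact (hmax hS').antisymm hA⟩
    refine hE.not_ge ?_
    simpa [edgeEnergy] using hE'
  have htan := tan_pi_div_pos hn
  have hsum : 0 ≤ edgeSum x := sum_nonneg fun _ _ => norm_nonneg _
  calc 2 * n * Real.tan (π / n) * shoelace z ≤ 2 * n * Real.tan (π / n) * shoelace x := by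
        have := hmax (z' := z) le_rfl
        gcongr
    _ = n * (2 * Real.tan (π / n) * shoelace x) := by ring
    _ ≤ n * edgeEnergy x := by gcongr; exact shoelace_le_edgeEnergy hn x
    _ = edgeSum x ^ 2 := (edgeSum_sq_of_equilateral x heq).symm
    _ ≤ edgeSum z ^ 2 := by gcongr; exact hxK.2

/-- A nondegenerate polygonal line attaining equality in the isoperimetric inequality is
equally spaced on a circle. -/
theorem exists_eq_of_edgeSum_sq_eq (hn : 3 ≤ n) (z : ZMod n → ℂ)
    (hz : ∀ k, orient (z k) (z (k + 1)) (z (k + 1 + 1)) ≠ 0)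
    (h : edgeSum z ^ 2 = 2 * n * Real.tan (π / n) * shoelace z) :
    ∃ a b : ℂ, ∀ k, z k = a + b * ZMod.stdAddChar k := by
  have hn0 : (0 : ℝ) < n := Nat.cast_pos.2 (NeZero.pos n)
  have htan := tan_pi_div_pos hn
  have heq : ∀ k, ‖z (k + 1) - z k‖ = ‖z (k + 1 + 1) - z (k + 1)‖ := by
    by_contra! ⟨k, hk⟩
    obtain ⟨z', hS, -, -, hA⟩ := exists_equalize (by lia) z k hk
    have h1 := shoelace_le_edgeSum_sq hn z'
    rw [hS, h] at h1
    have : 2 * n * Real.tan (π / n) * shoelace z < 2 * n * Real.tan (π / n) * shoelace z' := by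
      gcongr
      exact hA (hz k)
    linarith
  refine exists_eq_of_edgeEnergy_eq hn z (mul_left_cancel₀ hn0.ne' ?_)
  rw [← edgeSum_sq_of_equilateral z heq, h]
  ring

lemma orient_rotate (a b c : ℂ) : orient b c a = orient a b c := by
  simp only [orient_eq]
  ring

lemma orient_swap_left (a b c : ℂ) : orient b a c = -orient a b c := by
  simp only [orient_eq, cross]
  ring

@[simp]
lemma orient_self_left (a b : ℂ) : orient a b a = 0 := by simp [orient, cross]

@[simp]
lemma orient_self_right (a b : ℂ) : orient a b b = 0 := by
  simp only [orient, cross]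
  ring

lemma orient_combo (a b c d : ℂ) {s t : ℝ} (hst : s + t = 1) :
    orient a b (s • c + t • d) = s * orient a b c + t * orient a b d := by
  obtain rfl : s = 1 - t := by linarith
  simp [orient, cross]
  ring

lemma continuous_orient (a b : ℂ) : Continuous (orient a b) := by
  unfold orient cross
  fun_prop

lemma convex_orient_nonneg (a b : ℂ) : Convex ℝ {p | 0 ≤ orient a b p} := by
  intro p hp q hq s t hs ht hst
  rw [Set.mem_ofPred_eq] at *
  rw [orient_combo a b p q hst]
  positivity

lemma orient_smul_barycentric (a b c p : ℂ) :
    orient a b c • p = orient b c p • a + orient c a p • b + orient a b p • c := by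
  apply Complex.ext <;> simp [orient, cross] <;> ring

lemma orient_barycentric_sum (a b c p : ℂ) :
    orient b c p + orient c a p + orient a b p = orient a b c := by
  simp only [orient, cross, Complex.sub_re, Complex.sub_im]
  ring

lemma eq_barycentric {a b c : ℂ} (h : orient a b c ≠ 0) (p : ℂ) :
    p = (orient b c p / orient a b c) • a + (orient c a p / orient a b c) • b +
      (orient a b p / orient a b c) • c := by
  rw [← smul_right_inj h, orient_smul_barycentric]
  simp only [smul_add, smul_smul, mul_div_cancel₀ _ h]

/-- A triangle is the intersection of three half-planes. -/
lemma convexHull_triangle {a b c : ℂ} (h : 0 < orient a b c) :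
    convexHull ℝ {a, b, c} =
      {p | 0 ≤ orient a b p ∧ 0 ≤ orient b c p ∧ 0 ≤ orient c a p} := by
  apply Set.Subset.antisymm
  · refine convexHull_min ?_ ((convex_orient_nonneg _ _).inter
      ((convex_orient_nonneg _ _).inter (convex_orient_nonneg _ _)))
    have h1 : 0 < orient b c a := by rwa [orient_rotate]
    have h2 : 0 < orient c a b := by rwa [orient_rotate]
    rintro p (rfl | rfl | rfl) <;> simp [h.le, h1.le, h2.le]
  · rintro p ⟨h1, h2, h3⟩
    rw [eq_barycentric h.ne' p]
    have hs := (convex_convexHull ℝ {a, b, c}).sum_mem (t := univ)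
      (w := ![orient b c p / orient a b c, orient c a p / orient a b c,
        orient a b p / orient a b c]) (z := ![a, b, c]) ?_ ?_ ?_
    · simpa [Fin.sum_univ_three] using hs
    · intro i _
      fin_cases i <;> simp <;> positivity
    · simp only [Fin.sum_univ_three, Matrix.cons_val_zero, Matrix.cons_val_one, Matrix.cons_val]
      rw [← add_div, ← add_div, orient_barycentric_sum, div_self h.ne']
    · intro i _
      apply subset_convexHull
      fin_cases i <;> simp

lemma volume_standard_triangle :
    volume (convexHull ℝ {(0 : ℂ), 1, Complex.I}) = ENNReal.ofReal (1 / 2) := by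
  rw [convexHull_triangle (by simp [orient, cross])]
  have hset : {p : ℂ | 0 ≤ orient 0 1 p ∧ 0 ≤ orient 1 Complex.I p ∧ 0 ≤ orient Complex.I 0 p} =
      Complex.measurableEquivRealProd ⁻¹' {x : ℝ × ℝ | 0 ≤ x.2 ∧ x.1 + x.2 ≤ 1 ∧ 0 ≤ x.1} := by
    ext p
    simp [orient, cross]
    intro _ _
    constructor <;> intro <;> linarith
  have hmeas : MeasurableSet {x : ℝ × ℝ | 0 ≤ x.2 ∧ x.1 + x.2 ≤ 1 ∧ 0 ≤ x.1} := by
    measurability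
  rw [hset, Complex.volume_preserving_equiv_real_prod.measure_preimage hmeas.nullMeasurableSet,
    Measure.volume_eq_prod, Measure.prod_apply hmeas]
  have hslice (x : ℝ) : volume (Prod.mk x ⁻¹' {x : ℝ × ℝ | 0 ≤ x.2 ∧ x.1 + x.2 ≤ 1 ∧ 0 ≤ x.1}) =
      (Set.Icc 0 1).indicator (fun x => ENNReal.ofReal (1 - x)) x := by
    by_cases hx : 0 ≤ x
    · have : Prod.mk x ⁻¹' {x : ℝ × ℝ | 0 ≤ x.2 ∧ x.1 + x.2 ≤ 1 ∧ 0 ≤ x.1} =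
          Set.Icc 0 (1 - x) := by
        ext y
        simp [hx, le_sub_iff_add_le']
      rw [this, Real.volume_Icc, sub_zero]
      by_cases hx1 : x ≤ 1
      · rw [Set.indicator_of_mem (Set.mem_Icc.2 ⟨hx, hx1⟩)]
      · rw [Set.indicator_of_notMem (fun h => hx1 h.2), ENNReal.ofReal_of_nonpos (by linarith)]
    · rw [Set.indicator_of_notMem (fun h => hx h.1)]
      simp [hx]
  simp only [hslice]
  rw [lintegral_indicator measurableSet_Icc, ← ofReal_integral_eq_lintegral_ofReal]
  · rw [integral_Icc_eq_integral_Ioc, ← intervalIntegral.integral_of_le zero_le_one,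
      intervalIntegral.integral_sub (by simp) (by simp)]
    norm_num
  · exact (by fun_prop : Continuous fun x : ℝ => 1 - x).integrableOn_Icc
  · refine (ae_restrict_iff' measurableSet_Icc).2 (ae_of_all _ fun x hx => ?_)
    exact sub_nonneg.2 hx.2

open Pointwise in
lemma volume_triangle {a b c : ℂ} (h : 0 < orient a b c) :
    volume (convexHull ℝ {a, b, c}) = ENNReal.ofReal (orient a b c / 2) := by
  let L : ℂ →ₗ[ℝ] ℂ :=
    Complex.reLm.smulRight (b - a) + Complex.imLm.smulRight (c - a)
  have hdet : LinearMap.det L = orient a b c := by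
    rw [← LinearMap.det_toMatrix Complex.basisOneI, Matrix.det_fin_two]
    simp [LinearMap.toMatrix_apply, L, orient, cross]
    ring
  have himage : convexHull ℝ {a, b, c} = a +ᵥ L '' convexHull ℝ {(0 : ℂ), 1, Complex.I} := by
    rw [LinearMap.image_convexHull, ← convexHull_vadd]
    congr 1
    simp [Set.image_insert_eq, L, ← Set.image_vadd]
  rw [himage, measure_vadd, Measure.addHaar_image_linearMap, hdet, volume_standard_triangle,
    abs_of_pos h, ← ENNReal.ofReal_mul h.le]
  ring_nf

lemma volume_line {a b : ℂ} (hab : a ≠ b) : volume {p | orient a b p = 0} = 0 := by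
  let f : ℂ →ₗ[ℝ] ℝ := (b - a).re • Complex.imLm - (b - a).im • Complex.reLm
  have hset : {p | orient a b p = 0} = (fun p => p - a) ⁻¹' (LinearMap.ker f : Set ℂ) := by
    ext p
    simp [f, orient, cross]
  simp only [hset, sub_eq_add_neg, measure_preimage_add_right]
  refine Measure.addHaar_submodule _ _ fun htop => hab ?_
  have h1 : f 1 = 0 := by
    rw [← LinearMap.mem_ker, htop]; trivial
  have h2 : f Complex.I = 0 := by
    rw [← LinearMap.mem_ker, htop]; trivial
  simp [f] at h1 h2
  exact Complex.ext (by linarith) (by linarith)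

/-- The convex hull of points in counterclockwise convex position is an intersection of
half-planes, and its area is given by the shoelace formula. -/
lemma convexHull_and_volume_of_ccw {u : ℕ → ℂ} {m : ℕ} (hm : 2 ≤ m)
    (hu : ∀ i j k, i < j → j < k → k ≤ m → 0 < orient (u i) (u j) (u k)) :
    convexHull ℝ (u '' Set.Iic m) =
        {p | (∀ i < m, 0 ≤ orient (u i) (u (i + 1)) p) ∧ 0 ≤ orient (u m) (u 0) p} ∧
      0 ≤ ∑ i ∈ range m, cross (u i) (u (i + 1)) + cross (u m) (u 0) ∧
      volume (convexHull ℝ (u '' Set.Iic m)) =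
        ENNReal.ofReal ((∑ i ∈ range m, cross (u i) (u (i + 1)) + cross (u m) (u 0)) / 2) := by
  induction m, hm using Nat.le_induction with
  | base =>
    have h := hu 0 1 2 (by norm_num) (by norm_num) le_rfl
    have himage : u '' Set.Iic 2 = {u 0, u 1, u 2} := by
      have : Set.Iic 2 = {0, 1, 2} := by ext i; simp; lia
      rw [this, Set.image_insert_eq, Set.image_pair]
    rw [himage, volume_triangle h, convexHull_triangle h]
    refine ⟨?_, ?_, ?_⟩
    · ext p
      simp [show ∀ i, i < 2 ↔ i = 0 ∨ i = 1 by lia, or_imp, forall_and, and_assoc]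
    · rw [sum_range_succ, sum_range_one, ← orient_eq]
      exact h.le
    · rw [orient_eq, sum_range_succ, sum_range_one]
  | succ m hm ih =>
    obtain ⟨ihH, ih0, ihV⟩ := ih fun i j k hij hjk hk => hu i j k hij hjk (by lia)
    have htri : 0 < orient (u 0) (u m) (u (m + 1)) := hu _ _ _ (by lia) (by lia) le_rfl
    have hT := convexHull_triangle htri
    set S := convexHull ℝ (u '' Set.Iic m)
    set S' := convexHull ℝ (u '' Set.Iic (m + 1))
    set T := convexHull ℝ {u 0, u m, u (m + 1)}
    set H := {p | (∀ i < m + 1, 0 ≤ orient (u i) (u (i + 1)) p) ∧ 0 ≤ orient (u (m + 1)) (u 0) p}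
      with hH
    have hS'H : S' ⊆ H := by
      refine convexHull_min ?_ ?_
      · rintro _ ⟨k, hk, rfl⟩
        rw [Set.mem_Iic] at hk
        constructor
        · intro i hi
          rcases lt_trichotomy k i with hki | rfl | hki
          · rw [orient_rotate]
            exact (hu k i (i + 1) hki (by lia) hi).le
          · simp
          · rcases (Nat.succ_le_of_lt hki).eq_or_lt with rfl | hk'
            · simp
            · exact (hu _ _ _ (by lia) hk' hk).le
        · rcases k.eq_zero_or_pos with rfl | hk0
          · simp
          · rcases hk.eq_or_lt with rfl | hk'
            · simp
            · rw [← orient_rotate]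
              exact (hu 0 k (m + 1) hk0 hk' le_rfl).le
      · rw [hH, Set.ofPred_and]
        simp only [Set.ofPred_forall]
        exact (convex_iInter fun i => convex_iInter fun _ => convex_orient_nonneg _ _).inter
          (convex_orient_nonneg _ _)
    have hHST : H ⊆ S ∪ T := by
      rintro p ⟨hp1, hp2⟩
      rcases le_total 0 (orient (u m) (u 0) p) with h | h
      · left
        rw [ihH]
        exact ⟨fun i hi => hp1 i (by lia), h⟩
      · right
        rw [hT]
        rw [orient_swap_left] at h
        exact ⟨neg_nonpos.1 h, hp1 m (by lia), hp2⟩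
    have hSTS' : S ∪ T ⊆ S' := by
      refine Set.union_subset (convexHull_mono (Set.image_mono (Set.Iic_subset_Iic.2 (by lia))))
        (convexHull_mono ?_)
      rintro p (rfl | rfl | rfl) <;> refine Set.mem_image_of_mem _ ?_ <;> simp
    have hunion : S' = S ∪ T := (hS'H.trans hHST).antisymm hSTS'
    have hsum : ∑ i ∈ range (m + 1), cross (u i) (u (i + 1)) + cross (u (m + 1)) (u 0) =
        (∑ i ∈ range m, cross (u i) (u (i + 1)) + cross (u m) (u 0)) +
          orient (u 0) (u m) (u (m + 1)) := by
      rw [sum_range_succ, orient_eq]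
      simp only [cross]
      ring
    refine ⟨hS'H.antisymm (hHST.trans hSTS'), by rw [hsum]; positivity, ?_⟩
    have hne : u 0 ≠ u m := by
      intro h
      simp [h, orient, cross] at htri
    have hdisj : AEDisjoint volume S T := by
      refine measure_mono_null ?_ (volume_line hne)
      rintro p ⟨hpS, hpT⟩
      rw [ihH] at hpS
      rw [hT] at hpT
      have h := hpS.2
      rw [orient_swap_left] at h
      exact (neg_nonneg.1 h).antisymm hpT.1
    have hTm : NullMeasurableSet T volume :=
      (convex_convexHull ℝ _).nullMeasurableSet volume
    rw [hunion, measure_union₀ hTm hdisj, ihV, volume_triangle htri,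
      ← ENNReal.ofReal_add (by positivity) (by positivity), hsum]
    congr 1
    ring

/-- The points `z 0, …, z (n - 1)` are in convex position and counterclockwise order. -/
def IsCCW (z : ZMod n → ℂ) : Prop :=
  ∀ i j k : ZMod n, i.val < j.val → j.val < k.val → 0 < orient (z i) (z j) (z k)

lemma IsCCW.orient_pos {z : ZMod n → ℂ} (hz : IsCCW z) {i k : ZMod n} (hki : k ≠ i)
    (hki' : k ≠ i + 1) : 0 < orient (z i) (z (i + 1)) (z k) := by
  have hk := k.val_lt
  have hki_val : k.val ≠ i.val := fun h => hki (ZMod.val_injective n h)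
  have hki'_val : k.val ≠ (i + 1).val := fun h => hki' (ZMod.val_injective n h)
  have hi := i.val_lt
  have : Fact (1 < n) := ⟨by lia⟩
  have hval : (i + 1).val = (i.val + 1) % n := by rw [ZMod.val_add, ZMod.val_one]
  rcases (Nat.succ_le_of_lt hi).eq_or_lt with h | h
  · rw [show i.val + 1 = n from h, Nat.mod_self] at hval
    rw [← orient_rotate]
    exact hz _ _ _ (by lia) (by lia)
  · rw [Nat.mod_eq_of_lt h] at hval
    rcases lt_or_gt_of_ne hki_val with h' | h'
    · rw [orient_rotate]
      exact hz _ _ _ h' (by lia)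
    · exact hz _ _ _ (by lia) (by lia)

lemma sum_eq_sum_range_natCast {M : Type*} [AddCommMonoid M] (f : ZMod n → M) :
    ∑ k, f k = ∑ i ∈ range n, f (i : ℕ) := by
  symm
  refine sum_nbij' (fun i => (i : ZMod n)) ZMod.val (by simp) (by simp [ZMod.val_lt])
    (fun i hi => ZMod.val_natCast_of_lt (mem_range.1 hi)) (by simp) (by simp)

lemma IsCCW.convexHull_and_volume {z : ZMod n → ℂ} (hz : IsCCW z) (hn : 3 ≤ n) :
    convexHull ℝ (Set.range z) = {p | ∀ i, 0 ≤ orient (z i) (z (i + 1)) p} ∧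
      volume (convexHull ℝ (Set.range z)) = ENNReal.ofReal (shoelace z / 2) := by
  obtain ⟨m, rfl⟩ : ∃ m, n = m + 1 := ⟨n - 1, by lia⟩
  have h := convexHull_and_volume_of_ccw (u := fun i : ℕ => z i) (m := m) (by lia)
    (fun i j k hij hjk hk => hz _ _ _
      (by rwa [ZMod.val_natCast_of_lt (by lia), ZMod.val_natCast_of_lt (by lia)])
      (by rwa [ZMod.val_natCast_of_lt (by lia), ZMod.val_natCast_of_lt (by lia)]))
  have hcast : ((m : ZMod (m + 1)) + 1) = 0 := by exact_mod_cast ZMod.natCast_self (m + 1)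
  have hall {P : ZMod (m + 1) → Prop} : (∀ i, P i) ↔ (∀ i < m, P (i : ℕ)) ∧ P (m : ℕ) := by
    rw [← Nat.forall_lt_succ_right]
    refine ⟨fun h i _ => h i, fun h i => ?_⟩
    simpa using h i.val i.val_lt
  have hrange : (fun i : ℕ => z i) '' Set.Iic m = Set.range z := by
    ext p
    constructor
    · rintro ⟨i, _, rfl⟩
      exact ⟨_, rfl⟩
    · rintro ⟨i, rfl⟩
      exact ⟨i.val, Nat.le_of_lt_succ i.val_lt, by simp⟩
  have hsum : shoelace z = ∑ i ∈ range m, cross (z (i : ℕ)) (z ((i + 1 : ℕ) : ZMod (m + 1))) +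
      cross (z (m : ℕ)) (z (0 : ℕ)) := by
    rw [shoelace, sum_eq_sum_range_natCast, sum_range_succ, hcast]
    simp
  rw [hrange, ← hsum] at h
  refine ⟨h.1.trans ?_, h.2.2⟩
  ext p
  simp [hall, hcast]

lemma IsCCW.edge_subset {z : ZMod n → ℂ} (hz : IsCCW z) (i : ZMod n) :
    segment ℝ (z i) (z (i + 1)) ⊆ {p | ∀ j, 0 ≤ orient (z j) (z (j + 1)) p} := by
  have hconv : Convex ℝ {p | ∀ j, 0 ≤ orient (z j) (z (j + 1)) p} := by
    simp only [Set.ofPred_forall]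
    exact convex_iInter fun j => convex_orient_nonneg _ _
  have hvert (k : ZMod n) : z k ∈ {p | ∀ j, 0 ≤ orient (z j) (z (j + 1)) p} := by
    intro j
    by_cases h1 : k = j
    · simp [h1]
    by_cases h2 : k = j + 1
    · simp [h2]
    exact (hz.orient_pos h1 h2).le
  exact hconv.segment_subset (hvert _) (hvert _)

lemma orient_of_mem_segment {a b p : ℂ} (hp : p ∈ segment ℝ a b) : orient a b p = 0 := by
  obtain ⟨s, t, -, -, hst, rfl⟩ := hp
  rw [orient_combo a b a b hst]
  simp

lemma add_one_add_one_ne {n : ℕ} (hn : 3 ≤ n) (i : ZMod n) : i + 1 + 1 ≠ i := by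
  rw [add_assoc, Ne, add_eq_left]
  intro h
  have h2 : ((2 : ℕ) : ZMod n) = 0 := by
    rw [← h]; norm_num
  have := Nat.le_of_dvd two_pos ((ZMod.natCast_eq_zero_iff 2 n).1 h2)
  lia

lemma add_one_ne {n : ℕ} (hn : 3 ≤ n) (i : ZMod n) : i + 1 ≠ i := by
  have : Fact (1 < n) := ⟨by lia⟩
  simp

lemma IsCCW.orient_consecutive_pos {z : ZMod n → ℂ} (hz : IsCCW z) (hn : 3 ≤ n) (i : ZMod n) :
    0 < orient (z i) (z (i + 1)) (z (i + 1 + 1)) :=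
  hz.orient_pos (add_one_add_one_ne hn i) (add_one_ne hn _)

lemma IsCCW.mem_edge {z : ZMod n → ℂ} (hz : IsCCW z) (hn : 3 ≤ n) {p : ℂ}
    (hp : ∀ j, 0 ≤ orient (z j) (z (j + 1)) p) {i : ZMod n}
    (hi : orient (z i) (z (i + 1)) p = 0) : p ∈ segment ℝ (z i) (z (i + 1)) := by
  obtain ⟨j, rfl⟩ : ∃ j, i = j + 1 := ⟨i - 1, by ring⟩
  have hpos := hz.orient_consecutive_pos hn (j + 1)
  have hprev := hz.orient_consecutive_pos hn j
  have hbary := eq_barycentric hpos.ne' p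
  have hsum := orient_barycentric_sum (z (j + 1)) (z (j + 1 + 1)) (z (j + 1 + 1 + 1)) p
  rw [hi, zero_div, zero_smul, add_zero] at hbary
  rw [hi, add_zero] at hsum
  have hst := congrArg (· / orient (z (j + 1)) (z (j + 1 + 1)) (z (j + 1 + 1 + 1))) hsum
  simp only [add_div, div_self hpos.ne'] at hst
  refine ⟨_, _, div_nonneg (hp _) hpos.le, ?_, hst, hbary.symm⟩
  have hj := hp j
  rw [hbary, orient_combo _ _ _ _ hst, orient_self_right, mul_zero, zero_add] at hj
  exact nonneg_of_mul_nonneg_left hj hprev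

lemma IsCCW.frontier_eq {z : ZMod n → ℂ} (hz : IsCCW z) (hn : 3 ≤ n) :
    frontier (convexHull ℝ (Set.range z)) = ⋃ i, segment ℝ (z i) (z (i + 1)) := by
  rw [(hz.convexHull_and_volume hn).1]
  set S := {p | ∀ i, 0 ≤ orient (z i) (z (i + 1)) p} with hS
  have hclosed : IsClosed S := by
    rw [hS, Set.ofPred_forall]
    exact isClosed_iInter fun i => isClosed_le continuous_const (continuous_orient _ _)
  rw [hclosed.frontier_eq]
  ext p
  rw [Set.mem_iUnion]
  constructor
  · rintro ⟨hpS, hpint⟩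
    by_contra! hedge
    refine hpint (mem_interior.2 ⟨{q | ∀ i, 0 < orient (z i) (z (i + 1)) q},
      fun q hq i => (hq i).le, ?_, fun i => ?_⟩)
    · rw [Set.ofPred_forall]
      exact isOpen_iInter_of_finite fun i => isOpen_lt continuous_const (continuous_orient _ _)
    · exact (hpS i).lt_of_ne fun h => hedge i (hz.mem_edge hn hpS h.symm)
  · rintro ⟨i, hi⟩
    refine ⟨hz.edge_subset i hi, fun hpint => ?_⟩
    have hne : z (i + 1) - z i ≠ 0 := by
      intro h
      have := hz.orient_consecutive_pos hn i
      simp [orient, h, cross] at this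
    have hcont : Filter.Tendsto (fun t : ℝ => p - t * ((z (i + 1) - z i) * Complex.I))
        (nhdsWithin 0 (Set.Ioi 0)) (nhds p) := by
      have : Continuous (fun t : ℝ => p - t * ((z (i + 1) - z i) * Complex.I)) := by fun_prop
      have h := this.tendsto 0
      simp only [Complex.ofReal_zero, zero_mul, sub_zero] at h
      exact h.mono_left nhdsWithin_le_nhds
    obtain ⟨t, htS, ht⟩ := ((hcont.eventually (mem_interior_iff_mem_nhds.1 hpint)).and
      self_mem_nhdsWithin).exists
    have h1 := htS i
    have h2 : orient (z i) (z (i + 1)) (p - t * ((z (i + 1) - z i) * Complex.I)) =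
        orient (z i) (z (i + 1)) p - t * Complex.normSq (z (i + 1) - z i) := by
      simp [orient, cross, Complex.normSq_apply]
      ring
    have h3 : 0 < t * Complex.normSq (z (i + 1) - z i) := mul_pos ht (Complex.normSq_pos.2 hne)
    rw [h2, orient_of_mem_segment hi] at h1
    linarith

lemma IsCCW.edge_inter_subset {z : ZMod n → ℂ} (hz : IsCCW z) (hn : 3 ≤ n) {i j : ZMod n}
    (hij : j ≠ i) :
    segment ℝ (z i) (z (i + 1)) ∩ segment ℝ (z j) (z (j + 1)) ⊆ {z j, z (j + 1)} := by
  rintro p ⟨hi, s, t, hs, ht, hst, rfl⟩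
  have h := orient_of_mem_segment hi
  rw [orient_combo _ _ _ _ hst] at h
  by_cases hj : j = i + 1
  · subst hj
    have hpos := hz.orient_consecutive_pos hn i
    rw [orient_self_right, mul_zero, zero_add] at h
    obtain rfl : t = 0 := (mul_eq_zero.1 h).resolve_right hpos.ne'
    obtain rfl : s = 1 := by linarith
    simp
  · have hpos := hz.orient_pos hij hj
    have hnn := hz.edge_subset j (right_mem_segment ℝ _ _) i
    obtain rfl : s = 0 := by
      by_contra hs0
      have : 0 < s * orient (z i) (z (i + 1)) (z j) := by positivity
      have : 0 ≤ t * orient (z i) (z (i + 1)) (z (j + 1)) := mul_nonneg ht hnn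
      linarith
    obtain rfl : t = 1 := by linarith
    simp

lemma IsCCW.hausdorffMeasure_frontier {z : ZMod n → ℂ} (hz : IsCCW z) (hn : 3 ≤ n) :
    μH[1] (frontier (convexHull ℝ (Set.range z))) = ENNReal.ofReal (edgeSum z) := by
  have : NullSingletonClass (μH[1] : Measure ℂ) := Measure.nullSingletonClass_hausdorff ℂ one_pos
  rw [hz.frontier_eq hn, measure_iUnion₀]
  · simp only [hausdorffMeasure_segment, tsum_fintype]
    rw [edgeSum, ENNReal.ofReal_sum_of_nonneg fun _ _ => norm_nonneg _]
    simp only [edist_dist, dist_eq_norm_sub']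
  · intro i j hij
    exact ((Set.toFinite {z j, z (j + 1)}).countable.mono
      (hz.edge_inter_subset hn hij.symm)).measure_zero _
  · intro i
    have hcomp : IsCompact (segment ℝ (z i) (z (i + 1))) := by
      rw [← convexHull_pair]
      exact (Set.toFinite {z i, z (i + 1)}).isCompact_convexHull ℝ
    exact hcomp.measurableSet.nullMeasurableSet

lemma cross_eq_norm_mul_sin (u v : ℂ) :
    cross u v = ‖u‖ * ‖v‖ * Real.sin (v.arg - u.arg) := by
  rw [cross, Real.sin_sub, ← Complex.norm_mul_cos_arg u, ← Complex.norm_mul_sin_arg u,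
    ← Complex.norm_mul_cos_arg v, ← Complex.norm_mul_sin_arg v]
  ring

/-- The extreme points of a polygon can be listed in counterclockwise order. -/
lemma exists_isCCW_of_extremePoints {P : Set ℂ} (hn : 3 ≤ n) (hP : IsCompact P)
    (hPconv : Convex ℝ P) (hcard : (Set.extremePoints ℝ P).ncard = n) :
    ∃ z : ZMod n → ℂ, IsCCW z ∧ convexHull ℝ (Set.range z) = P := by
  have hfin : (Set.extremePoints ℝ P).Finite := Set.finite_of_ncard_ne_zero (by lia)
  have hhull : convexHull ℝ (Set.extremePoints ℝ P) = P := by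
    exact (hfin.isClosed_convexHull ℝ).closure_eq.symm.trans
      (closure_convexHull_extremePoints hP hPconv)
  have hext {p : ℂ} (hp : p ∈ Set.extremePoints ℝ P) {s : Set ℂ}
      (hs : s ⊆ Set.extremePoints ℝ P) (hps : p ∉ s) : p ∉ convexHull ℝ s := by
    have hconv := ((hPconv.mem_extremePoints_iff_convex_sdiff).1 hp).2
    intro h
    refine (convexHull_min ?_ hconv h).2 rfl
    exact fun q hq => ⟨extremePoints_subset (hs hq), fun hqp => hps (hqp ▸ hq)⟩
  lift Set.extremePoints ℝ P to Finset ℂ using hfin with V hV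
  rw [Set.ncard_coe_finset] at hcard
  obtain ⟨o, hoV, ho⟩ := V.exists_min_image (fun p => toLex (p.im, p.re))
    (card_pos.1 (by lia))
  have harg {p : ℂ} (hp : p ∈ V) (hpo : p ≠ o) :
      0 ≤ (p - o).arg ∧ (p - o).arg < π := by
    have h := ho p hp
    rw [Prod.Lex.toLex_le_toLex] at h
    rw [Complex.arg_nonneg_iff, Complex.arg_lt_pi_iff, Complex.sub_im, Complex.sub_re]
    rcases h with h | ⟨h1, h2⟩
    · exact ⟨by simpa using h.le, Or.inr (by simpa [sub_eq_zero] using h.ne')⟩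
    · exact ⟨by simpa using h1.le, Or.inl (by simpa using h2)⟩
  classical
  let f : ℂ → ℝ := fun p => if p = o then -1 else (p - o).arg
  have hfo : f o = -1 := if_pos rfl
  have hf {p : ℂ} (hp : p ≠ o) : f p = (p - o).arg := if_neg hp
  have hcol {p q : ℂ} (hp : p ∈ V) (hq : q ∈ V) (hpo : p ≠ o) (hqo : q ≠ o) (hpq : p ≠ q)
      (h : (p - o).arg = (q - o).arg) : ¬ ‖q - o‖ ≤ ‖p - o‖ := by
    intro hle
    have hp0 : 0 < ‖p - o‖ := norm_pos_iff.2 (sub_ne_zero.2 hpo)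
    have h' := (Complex.arg_eq_arg_iff (sub_ne_zero.2 hpo) (sub_ne_zero.2 hqo)).1 h
    refine hext hq (s := {o, p}) (by simp [Set.insert_subset_iff, hoV, hp])
      (by simp [hqo, hpq.symm]) ?_
    rw [convexHull_pair, segment_eq_image']
    refine ⟨‖q - o‖ / ‖p - o‖, ⟨by positivity, (div_le_one hp0).2 hle⟩, ?_⟩
    simp only [Complex.real_smul, Complex.ofReal_div]
    rw [h']
    ring
  have hfinj : Set.InjOn f V := by
    intro p hp q hq hpq
    rw [mem_coe] at hp hq
    by_cases hpo : p = o <;> by_cases hqo : q = o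
    · rw [hpo, hqo]
    · rw [hpo, hfo, hf hqo] at hpq
      linarith [(harg hq hqo).1]
    · rw [hqo, hfo, hf hpo] at hpq
      linarith [(harg hp hpo).1]
    · rw [hf hpo, hf hqo] at hpq
      by_contra hne
      rcases le_total ‖q - o‖ ‖p - o‖ with h | h
      · exact hcol hp hq hpo hqo hne hpq h
      · exact hcol hq hp hqo hpo (Ne.symm hne) hpq.symm h
  have hfne {p q : ℂ} (hp : p ∈ V) (hq : q ∈ V) (h : f p < f q) : q ≠ o := by
    rintro rfl
    rw [hfo] at h
    by_cases hpo : p = q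
    · rw [hpo, hfo] at h
      exact h.false
    · rw [hf hpo] at h
      linarith [(harg hp hpo).1]
  have hbase {p q : ℂ} (hp : p ∈ V) (hq : q ∈ V) (hpo : p ≠ o) (h : f p < f q) :
      0 < orient o p q := by
    have hqo := hfne hp hq h
    rw [hf hpo, hf hqo] at h
    rw [orient, cross_eq_norm_mul_sin]
    have h1 := norm_pos_iff.2 (sub_ne_zero.2 hpo)
    have h2 := norm_pos_iff.2 (sub_ne_zero.2 hqo)
    have h3 := Real.sin_pos_of_pos_of_lt_pi (sub_pos.2 h)
      (by linarith [(harg hp hpo).1, (harg hq hqo).2])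
    positivity
  have hccw {p q r : ℂ} (hp : p ∈ V) (hq : q ∈ V) (hr : r ∈ V) (hpq : f p < f q)
      (hqr : f q < f r) : 0 < orient p q r := by
    have hqo := hfne hp hq hpq
    by_cases hpo : p = o
    · subst hpo
      exact hbase hq hr hqo hqr
    by_contra! h
    refine hext hq (s := {o, p, r}) (by simp [Set.insert_subset_iff, hoV, hp, hr]) ?_ ?_
    · simp only [Set.mem_insert_iff, Set.mem_singleton_iff, not_or]
      exact ⟨hqo, fun h => (h ▸ hpq).false, fun h => (h ▸ hqr).false⟩
    · rw [convexHull_triangle (hbase hp hr hpo (hpq.trans hqr))]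
      refine ⟨(hbase hp hq hpo hpq).le, ?_, ?_⟩
      · have hneg : orient p r q = -orient p q r := by
          rw [orient_rotate q, orient_swap_left, orient_rotate]
        linarith
      · rw [← orient_rotate]
        exact (hbase hq hr hqo hqr).le
  have hcardT : (V.image f).card = n := by rw [card_image_of_injOn hfinj, hcard]
  have hex (i : Fin n) : ∃ p ∈ V, f p = (V.image f).orderEmbOfFin hcardT i :=
    mem_image.1 (orderEmbOfFin_mem _ hcardT i)
  choose g hgV hgf using hex
  have hglt {i j : Fin n} (hij : i < j) : f (g i) < f (g j) := by
    rw [hgf, hgf]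
    exact OrderEmbedding.strictMono _ hij
  have hrange : Set.range (fun i : ZMod n => g ⟨i.val, i.val_lt⟩) = V := by
    apply Set.Subset.antisymm
    · rintro _ ⟨i, rfl⟩
      exact hgV _
    · intro p hp
      have hfp : f p ∈ Set.range ((V.image f).orderEmbOfFin hcardT) := by
        rw [range_orderEmbOfFin]
        exact mem_coe.2 (mem_image_of_mem f hp)
      obtain ⟨i, hi⟩ := hfp
      refine ⟨(i.val : ℕ), hfinj (hgV _) hp ?_⟩
      rw [hgf, ← hi]
      congr 2
      exact ZMod.val_natCast_of_lt i.2
  refine ⟨fun i => g ⟨i.val, i.val_lt⟩, fun i j k hij hjk => ?_, by rw [hrange, hhull]⟩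
  exact hccw (hgV _) (hgV _) (hgV _) (hglt hij) (hglt hjk)

lemma orient_exp (α β γ : ℝ) :
    orient (Complex.exp ((2 * α : ℝ) * Complex.I)) (Complex.exp ((2 * β : ℝ) * Complex.I))
        (Complex.exp ((2 * γ : ℝ) * Complex.I)) =
      4 * Real.sin (β - α) * Real.sin (γ - β) * Real.sin (γ - α) := by
  simp only [orient, cross, Complex.sub_re, Complex.sub_im, Complex.exp_ofReal_mul_I_re,
    Complex.exp_ofReal_mul_I_im, Real.sin_sub, Real.sin_two_mul, Real.cos_two_mul]
  have hα := Real.sin_sq_add_cos_sq α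
  have hβ := Real.sin_sq_add_cos_sq β
  have hγ := Real.sin_sq_add_cos_sq γ
  generalize Real.sin α = a at *
  generalize Real.cos α = a' at *
  generalize Real.sin β = b at *
  generalize Real.cos β = b' at *
  generalize Real.sin γ = c at *
  generalize Real.cos γ = c' at *
  grobner

lemma orient_affine (a b x y w : ℂ) :
    orient (a + b * x) (a + b * y) (a + b * w) = Complex.normSq b * orient x y w := by
  simp only [orient, cross, Complex.normSq_apply, Complex.sub_re, Complex.sub_im, Complex.add_re,
    Complex.add_im, Complex.mul_re, Complex.mul_im]
  ring

lemma isCCW_regular {a b : ℂ} (hb : b ≠ 0) :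
    IsCCW fun k : ZMod n => a + b * ZMod.stdAddChar k := by
  intro i j k hij hjk
  have hn : (0 : ℝ) < n := by exact_mod_cast NeZero.pos n
  have hsin {p q : ZMod n} (hpq : p.val < q.val) :
      0 < Real.sin (π * q.val / n - π * p.val / n) := by
    have h1 : (p.val : ℝ) < q.val := by exact_mod_cast hpq
    have h2 : (q.val : ℝ) < n := by exact_mod_cast q.val_lt
    have h3 : (0 : ℝ) ≤ p.val := by positivity
    rw [← sub_div, ← mul_sub]
    refine Real.sin_pos_of_pos_of_lt_pi
      (div_pos (mul_pos Real.pi_pos (by linarith)) hn) ?_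
    rw [div_lt_iff₀ hn]
    exact mul_lt_mul_of_pos_left (by linarith) Real.pi_pos
  rw [orient_affine, ← ZMod.natCast_zmod_val i, ← ZMod.natCast_zmod_val j,
    ← ZMod.natCast_zmod_val k, stdAddChar_natCast, stdAddChar_natCast, stdAddChar_natCast,
    orient_exp]
  have := Complex.normSq_pos.2 hb
  have := hsin hij
  have := hsin hjk
  have := hsin (hij.trans hjk)
  positivity

lemma norm_stdAddChar (k : ZMod n) : ‖(ZMod.stdAddChar k : ℂ)‖ = 1 := by
  rw [ZMod.stdAddChar_apply, Circle.norm_coe]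

lemma stdAddChar_one : (ZMod.stdAddChar (1 : ZMod n) : ℂ) =
    Complex.exp ((2 * (π / n) : ℝ) * Complex.I) := by
  simpa using stdAddChar_natCast (n := n) 1

lemma edgeSum_regular (hn : 3 ≤ n) (a b : ℂ) :
    edgeSum (fun k : ZMod n => a + b * ZMod.stdAddChar k) =
      2 * n * Real.sin (π / n) * ‖b‖ := by
  have hone : ‖(ZMod.stdAddChar (1 : ZMod n) : ℂ) - 1‖ = 2 * Real.sin (π / n) := by
    have h := sin_pi_div_pos hn
    rw [← sq_eq_sq₀ (norm_nonneg _) (by positivity), ← Complex.normSq_eq_norm_sq,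
      stdAddChar_one, Complex.normSq_apply]
    simp only [Complex.sub_re, Complex.sub_im, Complex.exp_ofReal_mul_I_re,
      Complex.exp_ofReal_mul_I_im, Complex.one_re, Complex.one_im, Real.cos_two_mul,
      Real.sin_two_mul]
    linear_combination (4 * Real.cos (π / n) ^ 2 - 4) * Real.sin_sq_add_cos_sq (π / n)
  have hk (k : ZMod n) : ‖a + b * ZMod.stdAddChar (k + 1) - (a + b * ZMod.stdAddChar k)‖ =
      2 * Real.sin (π / n) * ‖b‖ := by
    rw [AddChar.map_add_eq_mul, ← hone]
    calc _ = ‖b * ZMod.stdAddChar k * (ZMod.stdAddChar (1 : ZMod n) - 1)‖ := by congr 1; ring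
      _ = _ := by rw [norm_mul, norm_mul, norm_stdAddChar]; ring
  simp only [edgeSum, hk, sum_const, card_univ, ZMod.card, nsmul_eq_mul]
  ring

lemma shoelace_regular (a b : ℂ) :
    shoelace (fun k : ZMod n => a + b * ZMod.stdAddChar k) =
      2 * n * Real.sin (π / n) * Real.cos (π / n) * ‖b‖ ^ 2 := by
  rw [← shoelace_sub_const _ a]
  have hk (k : ZMod n) : cross (b * ZMod.stdAddChar k) (b * ZMod.stdAddChar (k + 1)) =
      2 * Real.sin (π / n) * Real.cos (π / n) * ‖b‖ ^ 2 := by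
    have hmul (x y : ℂ) : cross x (x * y) = ‖x‖ ^ 2 * y.im := by
      rw [← Complex.normSq_eq_norm_sq, Complex.normSq_apply, cross, Complex.mul_re,
        Complex.mul_im]
      ring
    rw [AddChar.map_add_eq_mul, ← mul_assoc, hmul, norm_mul, norm_stdAddChar, stdAddChar_one,
      Complex.exp_ofReal_mul_I_im, Real.sin_two_mul]
    ring
  simp only [shoelace, add_sub_cancel_left, hk, sum_const, card_univ, ZMod.card, nsmul_eq_mul]
  ring

lemma edgeSum_sq_regular (hn : 3 ≤ n) (a b : ℂ) :
    edgeSum (fun k : ZMod n => a + b * ZMod.stdAddChar k) ^ 2 =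
      2 * n * Real.tan (π / n) * shoelace (fun k : ZMod n => a + b * ZMod.stdAddChar k) := by
  have hc := cos_pi_div_pos hn
  rw [edgeSum_regular hn, shoelace_regular, Real.tan_eq_sin_div_cos]
  field_simp

lemma exists_isometry_regular {a b a' b' : ℂ} (hb : b ≠ 0) (hbb' : ‖b‖ = ‖b'‖) :
    ∃ φ : ℂ ≃ᵃⁱ[ℝ] ℂ, ∀ x, φ (a + b * x) = a' + b' * x := by
  have hu : ‖b' / b‖ = 1 := by
    rw [norm_div, ← hbb', div_self (norm_ne_zero_iff.2 hb)]
  let u : Circle := ⟨b' / b, mem_sphere_zero_iff_norm.2 hu⟩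
  refine ⟨(rotation u).toAffineIsometryEquiv.trans
    (AffineIsometryEquiv.constVAdd ℝ ℂ (a' - b' / b * a)), fun x => ?_⟩
  change a' - b' / b * a + b' / b * (a + b * x) = a' + b' * x
  field_simp
  ring

/-- The standard identification of `ℂ` with the Euclidean plane. -/
noncomputable def toPlane : ℂ ≃ₗᵢ[ℝ] EuclideanSpace ℝ (Fin 2) :=
  Complex.orthonormalBasisOneI.repr

lemma polygonArea_image_toPlane {z : ZMod n → ℂ} (hz : IsCCW z) (hn : 3 ≤ n) :
    polygonArea (toPlane '' convexHull ℝ (Set.range z)) =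
      (ENNReal.ofReal (shoelace z / 2)).toReal := by
  have himage : toPlane '' convexHull ℝ (Set.range z) =
      toPlane.symm ⁻¹' convexHull ℝ (Set.range z) :=
    toPlane.toEquiv.image_eq_preimage_symm _
  rw [polygonArea, ← (hz.convexHull_and_volume hn).2, himage,
    toPlane.symm.measurePreserving.measure_preimage
      ((convex_convexHull ℝ _).nullMeasurableSet volume)]

lemma polygonPerimeter_image_toPlane {z : ZMod n → ℂ} (hz : IsCCW z) (hn : 3 ≤ n) :
    polygonPerimeter (toPlane '' convexHull ℝ (Set.range z)) = edgeSum z := by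
  have hfrontier : frontier (toPlane '' convexHull ℝ (Set.range z)) =
      toPlane '' frontier (convexHull ℝ (Set.range z)) :=
    (toPlane.toHomeomorph.image_frontier _).symm
  rw [polygonPerimeter, hfrontier, toPlane.isometry.hausdorffMeasure_image (Or.inl zero_le_one),
    hz.hausdorffMeasure_frontier hn, ENNReal.toReal_ofReal]
  exact sum_nonneg fun _ _ => norm_nonneg _

lemma exists_isCCW_of_isConvexNGon (hn : 3 ≤ n) {P : Set (EuclideanSpace ℝ (Fin 2))}
    (hP : IsConvexNGon n P) :
    ∃ z : ZMod n → ℂ, IsCCW z ∧ toPlane '' convexHull ℝ (Set.range z) = P := by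
  obtain ⟨hcompact, hconvex, -, hcard⟩ := hP
  have hext : Set.extremePoints ℝ (toPlane.symm '' P) =
      toPlane.symm '' Set.extremePoints ℝ P :=
    (image_extremePoints toPlane.symm.toLinearEquiv P).symm
  obtain ⟨z, hz, hzP⟩ := exists_isCCW_of_extremePoints hn
    (hcompact.image toPlane.symm.continuous)
    (hconvex.linear_image toPlane.symm.toLinearEquiv.toLinearMap)
    (by rw [hext, Set.ncard_image_of_injective _ toPlane.symm.injective, hcard])
  refine ⟨z, hz, ?_⟩
  rw [hzP, Set.image_image]
  simp

lemma exists_of_isRegularNGon {P : Set (EuclideanSpace ℝ (Fin 2))} (hP : IsRegularNGon n P) :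
    ∃ a b : ℂ, b ≠ 0 ∧
      toPlane '' convexHull ℝ (Set.range fun k : ZMod n => a + b * ZMod.stdAddChar k) = P := by
  obtain ⟨c, r, θ, hr, rfl⟩ := hP
  refine ⟨toPlane.symm c, r * Complex.exp (θ * Complex.I),
    mul_ne_zero (by exact_mod_cast hr.ne') (Complex.exp_ne_zero _), ?_⟩
  have hhull : toPlane '' convexHull ℝ (Set.range fun k : ZMod n =>
      toPlane.symm c + r * Complex.exp (θ * Complex.I) * ZMod.stdAddChar k) = convexHull ℝ
        (toPlane '' Set.range fun k : ZMod n =>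
          toPlane.symm c + r * Complex.exp (θ * Complex.I) * ZMod.stdAddChar k) :=
    toPlane.toLinearEquiv.toLinearMap.image_convexHull _
  have hvertex (m : ℕ) : toPlane (toPlane.symm c +
      r * Complex.exp (θ * Complex.I) * ZMod.stdAddChar (m : ZMod n)) =
        c + r • (WithLp.equiv 2 (Fin 2 → ℝ)).symm
          ![Real.cos (θ + 2 * π * m / n), Real.sin (θ + 2 * π * m / n)] := by
    have hexp : r * Complex.exp (θ * Complex.I) * ZMod.stdAddChar (m : ZMod n) =
        r • Complex.exp ((θ + 2 * π * m / n : ℝ) * Complex.I) := by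
      rw [stdAddChar_natCast, mul_assoc, ← Complex.exp_add, Complex.real_smul]
      congr 2
      push_cast
      ring
    rw [hexp, map_add, map_smul, LinearIsometryEquiv.apply_symm_apply]
    congr 2
    ext i
    fin_cases i
    · exact Complex.exp_ofReal_mul_I_re _
    · exact Complex.exp_ofReal_mul_I_im _
  rw [hhull, ← Set.range_comp]
  congr 1
  ext p
  constructor
  · rintro ⟨k, rfl⟩
    have h := hvertex k.val
    rw [ZMod.natCast_zmod_val] at h
    exact ⟨⟨k.val, k.val_lt⟩, h.symm⟩
  · rintro ⟨k, rfl⟩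
    exact ⟨(k : ℕ), hvertex _⟩

end PlanarPolygon

open PlanarPolygon

/-- A convex `n`-gon with the same area and perimeter as a regular `n`-gon is congruent to
that regular `n`-gon: some isometry of the plane maps one onto the other. -/
theorem ngon_with_area_perimeter_of_regular_is_congruent (n : ℕ) (hn : 3 ≤ n)
    (R Q : Set (EuclideanSpace ℝ (Fin 2)))
    (hRreg : IsRegularNGon n R) (hR : IsConvexNGon n R) (hQ : IsConvexNGon n Q)
    (harea : polygonArea Q = polygonArea R) (hper : polygonPerimeter Q = polygonPerimeter R) :
    ∃ φ : EuclideanSpace ℝ (Fin 2) ≃ᵢ EuclideanSpace ℝ (Fin 2), φ '' Q = R := by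
  have : NeZero n := ⟨by lia⟩
  obtain ⟨a, b, hb, rfl⟩ := exists_of_isRegularNGon hRreg
  obtain ⟨z, hz, rfl⟩ := exists_isCCW_of_isConvexNGon hn hQ
  have hreg := isCCW_regular (n := n) (a := a) hb
  rw [polygonArea_image_toPlane hz hn, polygonArea_image_toPlane hreg hn,
    ENNReal.toReal_ofReal', ENNReal.toReal_ofReal'] at harea
  rw [polygonPerimeter_image_toPlane hz hn, polygonPerimeter_image_toPlane hreg hn] at hper
  have hsin := sin_pi_div_pos hn
  have hshoelace :
      shoelace z = shoelace (fun k : ZMod n => a + b * ZMod.stdAddChar k) := by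
    have hpos : 0 < shoelace (fun k : ZMod n => a + b * ZMod.stdAddChar k) := by
      have hcos := cos_pi_div_pos hn
      rw [shoelace_regular]
      positivity
    rcases max_cases (shoelace z / 2) 0 with h | h <;>
    rcases max_cases (shoelace (fun k : ZMod n => a + b * ZMod.stdAddChar k) / 2) 0 with h' | h' <;>
    linarith
  obtain ⟨a', b', hz'⟩ := exists_eq_of_edgeSum_sq_eq hn z
    (fun k => (hz.orient_consecutive_pos hn k).ne')
    (by rw [hper, hshoelace, edgeSum_sq_regular hn])
  obtain rfl : z = fun k => a' + b' * ZMod.stdAddChar k := funext hz'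
  have hnorm : ‖b'‖ = ‖b‖ := by
    rw [edgeSum_regular hn, edgeSum_regular hn] at hper
    exact mul_left_cancel₀ (by positivity) hper
  obtain ⟨φ, hφ⟩ := exists_isometry_regular (a := a') (a' := a)
    (norm_ne_zero_iff.1 (hnorm ▸ norm_ne_zero_iff.2 hb)) hnorm
  refine ⟨toPlane.symm.toIsometryEquiv.trans
    (φ.toIsometryEquiv.trans toPlane.toIsometryEquiv), ?_⟩
  have hhull : φ '' convexHull ℝ (Set.range fun k : ZMod n => a' + b' * ZMod.stdAddChar k) =
      convexHull ℝ (Set.range fun k : ZMod n => a + b * ZMod.stdAddChar k) := by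
    refine (φ.toAffineEquiv.toAffineMap.image_convexHull _).trans ?_
    rw [← Set.range_comp]
    congr 2
    exact funext fun k => hφ _
  rw [← hhull, Set.image_image, Set.image_image]
  refine Set.image_congr fun x _ => ?_
  simp
end

section
/- The function f(α) = α²(π−α)²·cos(α) / ((2α−π)·sin²(α)) is injective on the interval (0, π/2); in fact it is strictly monotone there. -/
open Real

/-- A function vanishing at `0` with nonnegative derivative on `[0, ∞)` is nonnegative there. -/
theorem nonneg_of_hasDerivAt_nonneg {f f' : ℝ → ℝ} (hf : ∀ x, HasDerivAt f (f' x) x)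
    (h0 : f 0 = 0) (hf' : ∀ x, 0 ≤ x → 0 ≤ f' x) {x : ℝ} (hx : 0 ≤ x) : 0 ≤ f x := by
  have hmono : MonotoneOn f (Set.Ici 0) := by
    refine monotoneOn_of_deriv_nonneg (convex_Ici 0)
      (fun y _ => (hf y).continuousAt.continuousWithinAt)
      (fun y _ => (hf y).differentiableAt.differentiableWithinAt) fun y hy => ?_
    rw [interior_Ici, Set.mem_Ioi] at hy
    rw [(hf y).deriv]
    exact hf' y hy.le
  simpa [h0] using hmono Set.self_mem_Ici hx hx

theorem cos_le_taylor_four {x : ℝ} (hx : 0 ≤ x) :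
    Real.cos x ≤ 1 - x ^ 2 / 2 + x ^ 4 / 24 := by
  refine sub_nonneg.1 (nonneg_of_hasDerivAt_nonneg
    (f := fun y => 1 - y ^ 2 / 2 + y ^ 4 / 24 - Real.cos y)
    (f' := fun y => Real.sin y - (y - y ^ 3 / 6))
    (fun y => ?_) (by simp) (fun y hy => sub_nonneg.2 (sin_ge_sub_cube hy)) hx)
  refine HasDerivAt.congr_deriv ((((hasDerivAt_const y (1 : ℝ)).fun_sub
        ((hasDerivAt_pow 2 y).div_const 2)).fun_add
        ((hasDerivAt_pow 4 y).div_const 24)).fun_sub (Real.hasDerivAt_cos y)) ?_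
  push_cast
  ring

theorem sin_le_taylor_five {x : ℝ} (hx : 0 ≤ x) :
    Real.sin x ≤ x - x ^ 3 / 6 + x ^ 5 / 120 := by
  refine sub_nonneg.1 (nonneg_of_hasDerivAt_nonneg
    (f := fun y => y - y ^ 3 / 6 + y ^ 5 / 120 - Real.sin y)
    (f' := fun y => 1 - y ^ 2 / 2 + y ^ 4 / 24 - Real.cos y)
    (fun y => ?_) (by simp) (fun y hy => sub_nonneg.2 (cos_le_taylor_four hy)) hx)
  refine HasDerivAt.congr_deriv ((((hasDerivAt_id' y).fun_sub
        ((hasDerivAt_pow 3 y).div_const 6)).fun_add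
        ((hasDerivAt_pow 5 y).div_const 120)).fun_sub (Real.hasDerivAt_sin y)) ?_
  push_cast
  ring

theorem taylor_six_le_cos {x : ℝ} (hx : 0 ≤ x) :
    1 - x ^ 2 / 2 + x ^ 4 / 24 - x ^ 6 / 720 ≤ Real.cos x := by
  refine sub_nonneg.1 (nonneg_of_hasDerivAt_nonneg
    (f := fun y => Real.cos y - (1 - y ^ 2 / 2 + y ^ 4 / 24 - y ^ 6 / 720))
    (f' := fun y => y - y ^ 3 / 6 + y ^ 5 / 120 - Real.sin y)
    (fun y => ?_) (by simp) (fun y hy => sub_nonneg.2 (sin_le_taylor_five hy)) hx)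
  refine HasDerivAt.congr_deriv ((Real.hasDerivAt_cos y).fun_sub
      ((((hasDerivAt_const y (1 : ℝ)).fun_sub
        ((hasDerivAt_pow 2 y).div_const 2)).fun_add
        ((hasDerivAt_pow 4 y).div_const 24)).fun_sub
        ((hasDerivAt_pow 6 y).div_const 720))) ?_
  push_cast
  ring

theorem taylor_seven_le_sin {x : ℝ} (hx : 0 ≤ x) :
    x - x ^ 3 / 6 + x ^ 5 / 120 - x ^ 7 / 5040 ≤ Real.sin x := by
  refine sub_nonneg.1 (nonneg_of_hasDerivAt_nonneg
    (f := fun y => Real.sin y - (y - y ^ 3 / 6 + y ^ 5 / 120 - y ^ 7 / 5040))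
    (f' := fun y => Real.cos y - (1 - y ^ 2 / 2 + y ^ 4 / 24 - y ^ 6 / 720))
    (fun y => ?_) (by simp) (fun y hy => sub_nonneg.2 (taylor_six_le_cos hy)) hx)
  refine HasDerivAt.congr_deriv ((Real.hasDerivAt_sin y).fun_sub
      ((((hasDerivAt_id' y).fun_sub
        ((hasDerivAt_pow 3 y).div_const 6)).fun_add
        ((hasDerivAt_pow 5 y).div_const 120)).fun_sub
        ((hasDerivAt_pow 7 y).div_const 5040))) ?_
  push_cast
  ring

theorem cos_le_taylor_eight {x : ℝ} (hx : 0 ≤ x) :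
    Real.cos x ≤ 1 - x ^ 2 / 2 + x ^ 4 / 24 - x ^ 6 / 720 + x ^ 8 / 40320 := by
  refine sub_nonneg.1 (nonneg_of_hasDerivAt_nonneg
    (f := fun y => 1 - y ^ 2 / 2 + y ^ 4 / 24 - y ^ 6 / 720 + y ^ 8 / 40320 - Real.cos y)
    (f' := fun y => Real.sin y - (y - y ^ 3 / 6 + y ^ 5 / 120 - y ^ 7 / 5040))
    (fun y => ?_) (by simp) (fun y hy => sub_nonneg.2 (taylor_seven_le_sin hy)) hx)
  refine HasDerivAt.congr_deriv ((((((hasDerivAt_const y (1 : ℝ)).fun_sub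
        ((hasDerivAt_pow 2 y).div_const 2)).fun_add
        ((hasDerivAt_pow 4 y).div_const 24)).fun_sub
        ((hasDerivAt_pow 6 y).div_const 720)).fun_add
        ((hasDerivAt_pow 8 y).div_const 40320)).fun_sub (Real.hasDerivAt_cos y)) ?_
  push_cast
  ring

theorem sin_le_taylor_nine {x : ℝ} (hx : 0 ≤ x) :
    Real.sin x ≤ x - x ^ 3 / 6 + x ^ 5 / 120 - x ^ 7 / 5040 + x ^ 9 / 362880 := by
  refine sub_nonneg.1 (nonneg_of_hasDerivAt_nonneg
    (f := fun y => y - y ^ 3 / 6 + y ^ 5 / 120 - y ^ 7 / 5040 + y ^ 9 / 362880 - Real.sin y)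
    (f' := fun y => 1 - y ^ 2 / 2 + y ^ 4 / 24 - y ^ 6 / 720 + y ^ 8 / 40320 - Real.cos y)
    (fun y => ?_) (by simp) (fun y hy => sub_nonneg.2 (cos_le_taylor_eight hy)) hx)
  refine HasDerivAt.congr_deriv ((((((hasDerivAt_id' y).fun_sub
        ((hasDerivAt_pow 3 y).div_const 6)).fun_add
        ((hasDerivAt_pow 5 y).div_const 120)).fun_sub
        ((hasDerivAt_pow 7 y).div_const 5040)).fun_add
        ((hasDerivAt_pow 9 y).div_const 362880)).fun_sub (Real.hasDerivAt_sin y)) ?_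
  push_cast
  ring

/-- The trigonometric inequality expressing positivity of the derivative of `f`, in the variable
`u = π - 2 * α`, away from `π`. -/
theorem mul_sin_lt_mul_three_sub_cos_of_le_two {u : ℝ} (hu : 0 < u) (hu2 : u ≤ 2) :
    (2 * π ^ 2 + 6 * u ^ 2) * Real.sin u < u * (π ^ 2 - u ^ 2) * (3 - Real.cos u) := by
  have hπ : 9.8596 < π ^ 2 := by nlinarith [Real.pi_gt_d2]
  have hs := sin_le_taylor_nine hu.le
  have hc := cos_le_taylor_eight hu.le
  have hA := mul_le_mul_of_nonneg_left hs (show 0 ≤ 2 * π ^ 2 + 6 * u ^ 2 by positivity)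
  have hB := mul_le_mul_of_nonneg_left hc
    (show 0 ≤ u * (π ^ 2 - u ^ 2) from mul_nonneg hu.le (by nlinarith))
  generalize π ^ 2 = q at *
  have key : 0 < (5 * q / 6 - 8) + (1 / 2 - 7 * q / 120) * u ^ 2 + (q / 560 - 1 / 120) * (u ^ 2) ^ 2
      - (11 * q / 362880 + 1 / 5040) * (u ^ 2) ^ 3 + (u ^ 2) ^ 4 / 120960 := by
    have hs4 : u ^ 2 ≤ 4 := by nlinarith
    have hs0 : 0 ≤ u ^ 2 := sq_nonneg u
    generalize u ^ 2 = s at *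
    have hq : 0 ≤ 5 / 6 - 7 / 120 * s + s ^ 2 / 560 - 11 / 362880 * s ^ 3 := by
      nlinarith [mul_nonneg (sq_nonneg s) (sub_nonneg.2 hs4)]
    have h0 : 0 < (5 * 9.8596 / 6 - 8) + (1 / 2 - 7 * 9.8596 / 120) * s
        + (9.8596 / 560 - 1 / 120) * s ^ 2 - (11 * 9.8596 / 362880 + 1 / 5040) * s ^ 3 := by
      nlinarith [mul_nonneg (sq_nonneg s) (sub_nonneg.2 hs4)]
    have h1 := mul_nonneg (sub_nonneg.2 hπ.le) hq
    have h2 : 0 ≤ s ^ 4 := by positivity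
    linarith
  have := mul_pos (pow_pos hu 3) key
  linarith

/-- The counterpart of `mul_sin_lt_mul_three_sub_cos_of_le_two` near `π`, with `v = π - u`. -/
theorem mul_sin_lt_mul_three_add_cos {v : ℝ} (hv : 0 < v) (hv2 : v ≤ 1.15) :
    (2 * π ^ 2 + 6 * (π - v) ^ 2) * Real.sin v <
      (π - v) * (π ^ 2 - (π - v) ^ 2) * (3 + Real.cos v) := by
  have hp := Real.pi_gt_d2
  have hp' := Real.pi_lt_d2
  have hq : 9.8596 < π ^ 2 := by nlinarith
  have hq' : π ^ 2 < 9.9225 := by nlinarith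
  have hs := sin_le_taylor_five hv.le
  have hc := taylor_six_le_cos hv.le
  have hA := mul_le_mul_of_nonneg_left hs (show 0 ≤ 2 * π ^ 2 + 6 * (π - v) ^ 2 by positivity)
  have hB := mul_le_mul_of_nonneg_left hc
    (show 0 ≤ (π - v) * (π ^ 2 - (π - v) ^ 2) from
      mul_nonneg (by linarith) (by nlinarith))
  have key : 0 < (π ^ 2 / 3 - 2) - π / 2 * v + (π ^ 2 / 60 + 1 / 2) * v ^ 2 - π / 40 * v ^ 3
      - (π ^ 2 / 360 + 1 / 120) * v ^ 4 + π / 240 * v ^ 5 - v ^ 6 / 720 := by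
    have h0 : 0 < (9.8596 / 3 - 2) - 3.15 / 2 * v + (9.8596 / 60 + 1 / 2) * v ^ 2
        - 3.15 / 40 * v ^ 3 - (9.9225 / 360 + 1 / 120) * v ^ 4 - v ^ 6 / 720 := by
      have h3 : v ^ 3 ≤ 1.15 * v ^ 2 := by nlinarith [sq_nonneg v]
      have h4 : v ^ 4 ≤ 1.15 ^ 2 * v ^ 2 := by nlinarith [sq_nonneg v]
      have h6 : v ^ 6 ≤ 1.15 ^ 4 * v ^ 2 := by nlinarith [sq_nonneg v]
      nlinarith [sq_nonneg (v - 1.15)]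
    have h1 := mul_nonneg hv.le (sub_nonneg.2 hp'.le)
    have h2 := mul_nonneg (pow_nonneg hv.le 2) (sub_nonneg.2 hq.le)
    have h3 := mul_nonneg (pow_nonneg hv.le 3) (sub_nonneg.2 hp'.le)
    have h4 := mul_nonneg (pow_nonneg hv.le 4) (sub_nonneg.2 hq'.le)
    have h5 := mul_nonneg (pow_nonneg hv.le 5) Real.pi_pos.le
    linarith
  have := mul_pos (pow_pos hv 3) key
  linarith

theorem mul_sin_lt_mul_three_sub_cos {u : ℝ} (hu : 0 < u) (hu' : u < π) :
    (2 * π ^ 2 + 6 * u ^ 2) * Real.sin u < u * (π ^ 2 - u ^ 2) * (3 - Real.cos u) := by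
  rcases le_total u 2 with h | h
  · exact mul_sin_lt_mul_three_sub_cos_of_le_two hu h
  · have := mul_sin_lt_mul_three_add_cos (v := π - u) (by linarith)
      (by linarith [Real.pi_lt_d2])
    simpa [Real.sin_pi_sub, Real.cos_pi_sub, ← sub_eq_add_neg] using this

theorem strictMonoOn_trapezoid_function :
    StrictMonoOn
      (fun α : ℝ => α ^ 2 * (π - α) ^ 2 * Real.cos α / ((2 * α - π) * (Real.sin α) ^ 2))
      (Set.Ioo (0 : ℝ) (π / 2)) := by
  have hne : ∀ α ∈ Set.Ioo (0 : ℝ) (π / 2), (2 * α - π) * Real.sin α ^ 2 ≠ 0 := fun α hα =>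
    mul_ne_zero (by linarith [hα.2])
      (pow_ne_zero 2 (Real.sin_pos_of_pos_of_lt_pi hα.1 (by linarith [hα.2, Real.pi_pos])).ne')
  refine strictMonoOn_of_deriv_pos (convex_Ioo _ _)
    (ContinuousOn.div (by fun_prop) (by fun_prop) hne) fun α hα => ?_
  rw [interior_Ioo] at hα
  have hsin := Real.sin_pos_of_pos_of_lt_pi hα.1 (by linarith [hα.2, Real.pi_pos])
  have hN : HasDerivAt (fun α : ℝ => α ^ 2 * (π - α) ^ 2 * Real.cos α)
      (α * (π - α) * (2 * (π - 2 * α) * Real.cos α - α * (π - α) * Real.sin α)) α := by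
    refine HasDerivAt.congr_deriv (((hasDerivAt_pow 2 α).fun_mul
      (((hasDerivAt_id' α).const_sub π).fun_pow 2)).fun_mul (Real.hasDerivAt_cos α)) ?_
    push_cast
    ring
  have hD : HasDerivAt (fun α : ℝ => (2 * α - π) * Real.sin α ^ 2)
      (2 * Real.sin α ^ 2 + (2 * α - π) * (2 * Real.sin α * Real.cos α)) α := by
    refine HasDerivAt.congr_deriv ((((hasDerivAt_id' α).const_mul 2).sub_const π).fun_mul
      ((Real.hasDerivAt_sin α).fun_pow 2)) ?_
    push_cast
    ring
  rw [(hN.fun_div hD (hne α hα)).deriv]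
  refine div_pos ?_ (by have := hne α hα; positivity)
  have h := mul_sin_lt_mul_three_sub_cos (u := π - 2 * α) (by linarith [hα.2])
    (by linarith [hα.1])
  rw [Real.sin_pi_sub, Real.cos_pi_sub, Real.sin_two_mul, Real.cos_two_mul] at h
  have hpos : 0 < α * (π - α) * Real.sin α :=
    mul_pos (mul_pos hα.1 (by linarith [hα.2, Real.pi_pos])) hsin
  have hsq := Real.sin_sq_add_cos_sq α
  have hprod := mul_pos hpos (sub_pos.2 h)
  refine pos_of_mul_pos_right (a := 8) (lt_of_lt_of_eq hprod ?_) (by norm_num)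
  rw [← sub_eq_zero]
  linear_combination
    (-8 * α ^ 2 * (π ^ 3 - 4 * α * π ^ 2 + 5 * α ^ 2 * π - 2 * α ^ 3) * Real.sin α) * hsq

/-- The function `f(α) = α²(π−α)² cos α / ((2α−π) sin² α)` is injective on `(0, π/2)`;
in fact it is strictly monotone there. -/
theorem f_injective_strictMono_on :
    Set.InjOn
        (fun α : ℝ => α ^ 2 * (π - α) ^ 2 * Real.cos α / ((2 * α - π) * (Real.sin α) ^ 2))
        (Set.Ioo (0 : ℝ) (π / 2)) ∧
      (StrictMonoOn
          (fun α : ℝ => α ^ 2 * (π - α) ^ 2 * Real.cos α / ((2 * α - π) * (Real.sin α) ^ 2))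
          (Set.Ioo (0 : ℝ) (π / 2)) ∨
        StrictAntiOn
          (fun α : ℝ => α ^ 2 * (π - α) ^ 2 * Real.cos α / ((2 * α - π) * (Real.sin α) ^ 2))
          (Set.Ioo (0 : ℝ) (π / 2))) := by
  exact ⟨strictMonoOn_trapezoid_function.injOn, Or.inl strictMonoOn_trapezoid_function⟩
end
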